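/- Forney's second duality lemma: for a linear code C ⊆ F^n and a coordinate subset A, |A| = dim P_A(C) + dim (C^⊥)_A. -/

import Mathlib

variable {F : Type*} [Field F] {n : ℕ}

/-- The subspace of vectors vanishing on all coordinates in `A`. -/
def vanishOn (A : Finset (Fin n)) : Submodule F (Fin n → F) where
  carrier := {x | ∀ i ∈ A, x i = 0}
  add_mem' hx hy i hi := by simp [hx i hi, hy i hi]
  zero_mem' i _ := rfl
  smul_mem' c x hx i hi := by simp [hx i hi]

/-- The projection onto the coordinates in `A` (zeroing the other coordinates). -/
def projOn (A : Finset (Fin n)) : (Fin n → F) →ₗ[F] (Fin n → F) where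
  toFun x i := if i ∈ A then x i else 0
  map_add' x y := by ext i; by_cases h : i ∈ A <;> simp [h]
  map_smul' c x := by ext i; by_cases h : i ∈ A <;> simp [h]

/-- The dual code of `C` with respect to the standard bilinear form. -/
def dualCode (C : Submodule F (Fin n → F)) : Submodule F (Fin n → F) where
  carrier := {y | ∀ c ∈ C, ∑ i, c i * y i = 0}
  add_mem' := by
    intro x y hx hy c hc
    simp only [Set.mem_setOf_eq, Pi.add_apply, mul_add, Finset.sum_add_distrib] at *
    simp [hx c hc, hy c hc]
  zero_mem' := by intro c _; simp
  smul_mem' := by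
    intro a x hx c hc
    have h := hx c hc
    calc ∑ i, c i * (a • x) i = a * ∑ i, c i * x i := by
          simp [Finset.mul_sum, mul_left_comm]
      _ = 0 := by rw [h, mul_zero]

open Module in
/-- In `ι → F`, a subspace and its orthogonal for the dot product have complementary dimensions. -/
theorem finrank_add_finrank_orthogonal_toBilin'_one {ι : Type*} [Fintype ι] [DecidableEq ι]
    (W : Submodule F (ι → F)) :
    finrank F W + finrank F ((1 : Matrix ι ι F).toBilin'.orthogonal W) = Fintype.card ι := by
  have hB : (1 : Matrix ι ι F).toBilin'.Nondegenerate :=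
    LinearMap.BilinForm.nondegenerate_toBilin'_of_det_ne_zero' _ (by simp)
  rw [LinearMap.BilinForm.finrank_orthogonal hB, ← finrank_fintype_fun_eq_card F (η := ι)]
  exact Nat.add_sub_of_le W.finrank_le

/-- Extension by zero from the coordinates in `A` to all coordinates. -/
def extendZero (A : Finset (Fin n)) : (A → F) →ₗ[F] (Fin n → F) where
  toFun x i := if h : i ∈ A then x ⟨i, h⟩ else 0
  map_add' x y := by ext i; by_cases h : i ∈ A <;> simp [h]
  map_smul' c x := by ext i; by_cases h : i ∈ A <;> simp [h]

theorem extendZero_apply_coe (A : Finset (Fin n)) (x : A → F) (i : A) :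
    extendZero A x i = x i := by
  simp [extendZero]

theorem extendZero_apply_of_notMem {A : Finset (Fin n)} (x : A → F) {i : Fin n} (hi : i ∉ A) :
    extendZero A x i = 0 := by
  simp [extendZero, hi]

theorem extendZero_injective (A : Finset (Fin n)) :
    Function.Injective (extendZero A : (A → F) →ₗ[F] (Fin n → F)) := by
  intro x y h
  ext i
  rw [← extendZero_apply_coe A x i, h, extendZero_apply_coe]

theorem projOn_eq_extendZero_comp (A : Finset (Fin n)) :
    (projOn A : (Fin n → F) →ₗ[F] (Fin n → F)) =
      extendZero A ∘ₗ LinearMap.funLeft F F ((↑) : A → Fin n) := by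
  ext
  simp [projOn, extendZero, LinearMap.funLeft]

theorem extendZero_restrict {A : Finset (Fin n)} {x : Fin n → F} (hx : x ∈ vanishOn Aᶜ) :
    extendZero A (fun i : A => x i) = x := by
  ext i
  by_cases hi : i ∈ A
  · exact extendZero_apply_coe A _ ⟨i, hi⟩
  · rw [extendZero_apply_of_notMem _ hi, hx i (Finset.mem_compl.2 hi)]

theorem sum_mul_extendZero (A : Finset (Fin n)) (c : Fin n → F) (y : A → F) :
    ∑ i, c i * extendZero A y i = ∑ i : A, c i * y i := by
  rw [← Finset.sum_subset A.subset_univ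
    fun i _ hi => by rw [extendZero_apply_of_notMem y hi, mul_zero], ← Finset.sum_coe_sort]
  simp only [extendZero_apply_coe]

theorem dualCode_inf_vanishOn_compl (C : Submodule F (Fin n → F)) (A : Finset (Fin n)) :
    dualCode C ⊓ vanishOn Aᶜ =
      ((1 : Matrix A A F).toBilin'.orthogonal
        (C.map (LinearMap.funLeft F F ((↑) : A → Fin n)))).map (extendZero A) := by
  have key (y : A → F) : y ∈ (1 : Matrix A A F).toBilin'.orthogonal
      (C.map (LinearMap.funLeft F F ((↑) : A → Fin n))) ↔ extendZero A y ∈ dualCode C := by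
    change _ ↔ ∀ c ∈ C, ∑ i, c i * extendZero A y i = 0
    simp [LinearMap.BilinForm.mem_orthogonal_iff, Matrix.toBilin'_apply', dotProduct,
      LinearMap.funLeft_apply, sum_mul_extendZero, -Finset.univ_eq_attach]
  ext x
  constructor
  · rintro ⟨hx, hxA⟩
    refine ⟨fun i => x i, (key _).2 ?_, extendZero_restrict hxA⟩
    rwa [extendZero_restrict hxA]
  · rintro ⟨y, hy, rfl⟩
    exact ⟨(key y).1 hy, fun i hi => extendZero_apply_of_notMem y (Finset.mem_compl.1 hi)⟩

/-- Forney's second duality lemma: `|A| = dim P_A(C) + dim (C^⊥)_A`. -/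
theorem stmt_12 (C : Submodule F (Fin n → F)) (A : Finset (Fin n)) :
    A.card = Module.finrank F (C.map (projOn A)) +
      Module.finrank F (dualCode C ⊓ vanishOn Aᶜ : Submodule F (Fin n → F)) := by
  have hmap (W : Submodule F (A → F)) :
      Module.finrank F (W.map (extendZero A)) = Module.finrank F W :=
    (Submodule.equivMapOfInjective _ (extendZero_injective A) W).finrank_eq.symm
  rw [projOn_eq_extendZero_comp, Submodule.map_comp, dualCode_inf_vanishOn_compl, hmap, hmap,
    finrank_add_finrank_orthogonal_toBilin'_one, Fintype.card_coe]
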